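/- Let k ≥ 2, ℓ ∈ {2,3}, n ≥ 3k − ℓ, and let 𝓕 ⊆ ([n] choose k) with |A∩B| + |B∩C| + |C∩A| ≥ ℓ for all A,B,C ∈ 𝓕. If ℓ = 2 then |𝓕| ≤ C(n+1, k−1) + C(n, k−2); if ℓ = 3 then |𝓕| ≤ C(n, k−1) + 2·C(n, k−3) + 3·C(n−1, k−3). -/

import Mathlib

/-- `d A B C = |A∩B| + |B∩C| + |C∩A|`. -/
def dd (A B C : Finset ℕ) : ℕ := (A ∩ B).card + (B ∩ C).card + (C ∩ A).card

open Finset in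
/-- Each set of a shifted family either stays in the family (and can then be swapped if it contains
only `j`), or contains only `i` and its swap belongs to the family. -/
lemma exists_swap_of_mem_compression {i j : ℕ} (hij : i ≠ j) {F : Finset (Finset ℕ)}
    {A : Finset ℕ} (hA : A ∈ UV.compression {i} {j} F) :
    ∃ moved : Bool,
      (moved = true → i ∈ A ∧ j ∉ A ∧ A.map (Equiv.swap i j).toEmbedding ∈ F) ∧
      (moved = false → A ∈ F ∧
        (i ∉ A → j ∈ A → A.map (Equiv.swap i j).toEmbedding ∈ F)) := by
  have swap_eq : ∀ B : Finset ℕ, i ∉ B → j ∈ B →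
      B.map (Equiv.swap i j).toEmbedding = (B ∪ {i}) \ {j} := by
    intro B hi hj
    ext x
    simp only [mem_map_equiv, Equiv.symm_swap, mem_sdiff, mem_union, mem_singleton]
    by_cases hxi : x = i
    · subst hxi; simp [hj, hij]
    by_cases hxj : x = j
    · subst hxj; simp [hi]
    simp [Equiv.swap_apply_of_ne_of_ne hxi hxj, hxi, hxj]
  rw [UV.mem_compression] at hA
  rcases hA with ⟨h1, h2⟩ | ⟨h1, B, hB, h2⟩
  · refine ⟨false, by simp, fun _ => ⟨h1, fun hi hj => ?_⟩⟩
    rw [swap_eq A hi hj]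
    simpa [UV.compress, hi, hj] using h2
  · refine ⟨true, fun _ => ?_, by simp⟩
    by_cases hc : i ∉ B ∧ j ∈ B
    · have hAB : A = B.map (Equiv.swap i j).toEmbedding := by
        rw [swap_eq B hc.1 hc.2, ← h2]
        simp [UV.compress, hc.1, hc.2]
      have hinv : A.map (Equiv.swap i j).toEmbedding = B := by
        ext x; simp [hAB, mem_map_equiv]
      refine ⟨?_, ?_, hinv ▸ hB⟩
      · simp [hAB, mem_map_equiv, hc.2]
      · simp [hAB, mem_map_equiv, hc.1]
    · have hBA : B = A := by
        rw [← h2, UV.compress, if_neg]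
        simpa using hc
      exact absurd (hBA ▸ hB) h1

open Finset in
lemma card_inter_eq_sdiff_pair {i j : ℕ} (hij : i ≠ j) (A B : Finset ℕ) :
    (A ∩ B).card = ((A \ {i, j}) ∩ (B \ {i, j})).card
      + ((decide (i ∈ A) && decide (i ∈ B)).toNat + (decide (j ∈ A) && decide (j ∈ B)).toNat) := by
  rw [← card_inter_add_card_sdiff (A ∩ B) {i, j}, add_comm]
  congr 1
  · congr 1; ext x; simp; tauto
  · by_cases h1 : i ∈ A <;> by_cases h2 : i ∈ B <;> by_cases h3 : j ∈ A <;> by_cases h4 : j ∈ B <;>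
      simp [h1, h2, h3, h4, hij, inter_insert_of_mem, inter_insert_of_notMem]

/-- The part of `dd` contributed by two points, in terms of the traces of the three sets there. -/
def pairContribution (a a' b b' c c' : Bool) : ℕ :=
  ((a && b).toNat + (a' && b').toNat) + ((b && c).toNat + (b' && c').toNat)
    + ((c && a).toNat + (c' && a').toNat)

lemma dd_eq_sdiff_pair {i j : ℕ} (hij : i ≠ j) (A B C : Finset ℕ) :
    dd A B C = dd (A \ {i, j}) (B \ {i, j}) (C \ {i, j})
      + pairContribution (decide (i ∈ A)) (decide (j ∈ A)) (decide (i ∈ B)) (decide (j ∈ B))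
        (decide (i ∈ C)) (decide (j ∈ C)) := by
  unfold dd pairContribution
  rw [card_inter_eq_sdiff_pair hij A B, card_inter_eq_sdiff_pair hij B C,
    card_inter_eq_sdiff_pair hij C A]
  omega

/-- Whether a set with trace `(x, y)` on `(i, j)`, moved by the shift or not, may be swapped
(`s = true`) or left alone (`s = false`) so as to land in the unshifted family. -/
def swapAllowed (x y moved s : Bool) : Bool :=
  if moved then s else !s || (!x && y)

lemma exists_swaps_pairContribution_le : ∀ a a' u b b' v c c' w : Bool,
    (u = true → a = true ∧ a' = false) → (v = true → b = true ∧ b' = false) →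
    (w = true → c = true ∧ c' = false) →
    ∃ s t r : Bool, swapAllowed a a' u s = true ∧ swapAllowed b b' v t = true ∧
      swapAllowed c c' w r = true ∧
      pairContribution (bif s then a' else a) (bif s then a else a')
        (bif t then b' else b) (bif t then b else b')
        (bif r then c' else c) (bif r then c else c') ≤ pairContribution a a' b b' c c' := by
  decide

open Finset in
/-- Shifting preserves the triple intersection condition. -/
lemma le_dd_of_mem_compression {ℓ i j : ℕ} (hij : i ≠ j) {F : Finset (Finset ℕ)}
    (hF : ∀ A ∈ F, ∀ B ∈ F, ∀ C ∈ F, ℓ ≤ dd A B C) :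
    ∀ A ∈ UV.compression {i} {j} F, ∀ B ∈ UV.compression {i} {j} F,
      ∀ C ∈ UV.compression {i} {j} F, ℓ ≤ dd A B C := by
  intro A hA B hB C hC
  obtain ⟨u, hu, hu'⟩ := exists_swap_of_mem_compression hij hA
  obtain ⟨v, hv, hv'⟩ := exists_swap_of_mem_compression hij hB
  obtain ⟨w, hw, hw'⟩ := exists_swap_of_mem_compression hij hC
  obtain ⟨s, t, r, hs, ht, hr, hle⟩ := exists_swaps_pairContribution_le
    (decide (i ∈ A)) (decide (j ∈ A)) u (decide (i ∈ B)) (decide (j ∈ B)) v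
    (decide (i ∈ C)) (decide (j ∈ C)) w
    (fun h => by simpa using ⟨(hu h).1, (hu h).2.1⟩)
    (fun h => by simpa using ⟨(hv h).1, (hv h).2.1⟩)
    (fun h => by simpa using ⟨(hw h).1, (hw h).2.1⟩)
  have key : ∀ (X : Finset ℕ) (m z : Bool),
      (m = true → i ∈ X ∧ j ∉ X ∧ X.map (Equiv.swap i j).toEmbedding ∈ F) →
      (m = false → X ∈ F ∧ (i ∉ X → j ∈ X → X.map (Equiv.swap i j).toEmbedding ∈ F)) →
      swapAllowed (decide (i ∈ X)) (decide (j ∈ X)) m z = true →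
      ∃ Y ∈ F, Y \ {i, j} = X \ {i, j} ∧
        decide (i ∈ Y) = (bif z then decide (j ∈ X) else decide (i ∈ X)) ∧
        decide (j ∈ Y) = (bif z then decide (i ∈ X) else decide (j ∈ X)) := by
    intro X m z h1 h2 h3
    cases z
    · refine ⟨X, ?_, rfl, rfl, rfl⟩
      cases m
      · exact (h2 rfl).1
      · simp [swapAllowed] at h3
    · refine ⟨X.map (Equiv.swap i j).toEmbedding, ?_, ?_, by simp [mem_map_equiv],
        by simp [mem_map_equiv]⟩
      · cases m
        · simp [swapAllowed] at h3
          exact (h2 rfl).2 h3.1 h3.2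
        · exact (h1 rfl).2.2
      · ext x
        simp only [mem_map_equiv, Equiv.symm_swap, mem_sdiff, mem_insert, mem_singleton, not_or]
        refine and_congr_left fun hx => ?_
        rw [Equiv.swap_apply_of_ne_of_ne hx.1 hx.2]
  obtain ⟨A', hA', eA, eA1, eA2⟩ := key A u s hu hu' hs
  obtain ⟨B', hB', eB, eB1, eB2⟩ := key B v t hv hv' ht
  obtain ⟨C', hC', eC, eC1, eC2⟩ := key C w r hw hw' hr
  have h := hF A' hA' B' hB' C' hC'
  rw [dd_eq_sdiff_pair hij, eA, eB, eC, eA1, eA2, eB1, eB2, eC1, eC2] at h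
  rw [dd_eq_sdiff_pair hij]
  omega

open Finset in
/-- A family satisfying the triple intersection condition can be replaced by one of the same size
that is stable under replacing the largest point `n + 1` by any other point. -/
lemma exists_stable_family {ℓ n k : ℕ} {F : Finset (Finset ℕ)}
    (hsub : F ⊆ (Icc 1 (n + 1)).powersetCard k)
    (hF : ∀ A ∈ F, ∀ B ∈ F, ∀ C ∈ F, ℓ ≤ dd A B C) :
    ∃ G : Finset (Finset ℕ), G.card = F.card ∧ G ⊆ (Icc 1 (n + 1)).powersetCard k ∧
      (∀ A ∈ G, ∀ B ∈ G, ∀ C ∈ G, ℓ ≤ dd A B C) ∧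
      ∀ A, n + 1 ∉ A → insert (n + 1) A ∈ G → ∀ x ∈ Icc 1 n, x ∉ A → insert x A ∈ G := by
  induction hN : (F.filter (n + 1 ∈ ·)).card using Nat.strong_induction_on generalizing F with
  | _ N ih =>
    by_cases hst : ∀ A, n + 1 ∉ A → insert (n + 1) A ∈ F → ∀ x ∈ Icc 1 n, x ∉ A → insert x A ∈ F
    · exact ⟨F, rfl, hsub, hF, hst⟩
    push Not at hst
    obtain ⟨A, hA, hAF, x, hx, hxA, hxF⟩ := hst
    have hxn : x ≠ n + 1 := by have := mem_Icc.1 hx; omega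
    set G := UV.compression {x} {n + 1} F with hG
    have hcomp : ∀ B : Finset ℕ, x ∉ B → n + 1 ∈ B →
        UV.compress {x} {n + 1} B = insert x (B.erase (n + 1)) := by
      intro B h1 h2
      ext y
      simp [UV.compress, h1, h2]
      grind
    have hGsub : G ⊆ (Icc 1 (n + 1)).powersetCard k := by
      intro B hB
      rw [hG, UV.mem_compression] at hB
      rcases hB with hB | ⟨-, B', hB', rfl⟩
      · exact hsub hB.1
      · by_cases hc : x ∉ B' ∧ n + 1 ∈ B'
        · rw [hcomp B' hc.1 hc.2]
          have hm := mem_powersetCard.1 (hsub hB')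
          rw [mem_powersetCard]
          constructor
          · intro y hy
            rcases mem_insert.1 hy with rfl | hy
            · have := mem_Icc.1 hx
              exact mem_Icc.2 ⟨this.1, by omega⟩
            · exact hm.1 (mem_of_mem_erase hy)
          · rw [card_insert_of_notMem (by simp [hc.1]), card_erase_of_mem hc.2]
            have := card_pos.2 ⟨_, hc.2⟩
            omega
        · rw [UV.compress, if_neg (by simpa using hc)]
          exact hsub hB'
    have hfil : G.filter (n + 1 ∈ ·) ⊂ F.filter (n + 1 ∈ ·) := by
      rw [ssubset_iff_of_subset]
      · refine ⟨insert (n + 1) A, by simp [hAF], ?_⟩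
        rw [mem_filter, hG, UV.mem_compression]
        have hce : UV.compress {x} {n + 1} (insert (n + 1) A) = insert x A := by
          rw [hcomp _ (by simp [hxn, hxA]) (by simp), erase_insert hA]
        rw [hce]
        simp [hAF, hxF]
      · intro B hB
        rw [mem_filter] at hB ⊢
        refine ⟨?_, hB.2⟩
        have hBG := hB.1
        rw [hG, UV.mem_compression] at hBG
        rcases hBG with hBG | ⟨-, B', hB', hBB⟩
        · exact hBG.1
        · by_cases hc : x ∉ B' ∧ n + 1 ∈ B'
          · rw [hcomp B' hc.1 hc.2] at hBB
            have := hB.2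
            rw [← hBB] at this
            simp [hxn.symm] at this
          · rw [UV.compress, if_neg (by simpa using hc)] at hBB
            exact hBB ▸ hB'
    obtain ⟨H, hH, hH'⟩ := ih _ (hN ▸ card_lt_card hfil) hGsub
      (le_dd_of_mem_compression hxn hF) rfl
    exact ⟨H, hH.trans (UV.card_compression _ _ _), hH'⟩

open Finset in
lemma card_union_add_dd {A B C : Finset ℕ} (h : dd A B C ≤ 2) :
    (A ∪ B ∪ C).card + dd A B C = A.card + B.card + C.card := by
  have h1 := card_union_add_card_inter A B
  have h2 := card_union_add_card_inter (A ∪ B) C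
  have h3 := card_union_add_card_inter (A ∩ C) (B ∩ C)
  rw [← union_inter_distrib_right] at h3
  have h4 : ((A ∩ C) ∩ (B ∩ C)).card ≤ (A ∩ B).card := card_le_card (by grind)
  have h5 : ((A ∩ C) ∩ (B ∩ C)).card ≤ (B ∩ C).card := card_le_card (by grind)
  have h6 : ((A ∩ C) ∩ (B ∩ C)).card ≤ (A ∩ C).card := card_le_card (by grind)
  unfold dd at *
  rw [inter_comm C A] at *
  omega

open Finset in
lemma insert_inter_insert_of_ne {A B : Finset ℕ} {x y : ℕ} (hxy : x ≠ y) (hx : x ∉ B)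
    (hy : y ∉ A) : insert x A ∩ insert y B = A ∩ B := by
  rw [insert_inter_of_notMem (by simp [hxy, hx]), inter_insert_of_notMem hy]

open Finset in
/-- In a stable family the link of the largest point satisfies the triple intersection
condition. -/
lemma le_dd_link {ℓ n m : ℕ} (hℓ : ℓ = 2 ∨ ℓ = 3) (hn : 3 * m + 6 ≤ n + ℓ)
    {F : Finset (Finset ℕ)} (hF : ∀ A ∈ F, ∀ B ∈ F, ∀ C ∈ F, ℓ ≤ dd A B C)
    {A B C : Finset ℕ} (hA : A ∈ (Icc 1 n).powersetCard (m + 1))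
    (hB : B ∈ (Icc 1 n).powersetCard (m + 1)) (hC : C ∈ (Icc 1 n).powersetCard (m + 1))
    (hA' : insert (n + 1) A ∈ F) (hB' : insert (n + 1) B ∈ F)
    (hBx : ∀ x ∈ Icc 1 n, x ∉ B → insert x B ∈ F)
    (hCx : ∀ x ∈ Icc 1 n, x ∉ C → insert x C ∈ F) : ℓ ≤ dd A B C := by
  rw [mem_powersetCard] at hA hB hC
  have hnot : ∀ X : Finset ℕ, X ⊆ Icc 1 n → n + 1 ∉ X := fun X hX h => by
    have := mem_Icc.1 (hX h); omega
  have nA := hnot A hA.1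
  have nB := hnot B hB.1
  have nC := hnot C hC.1
  by_contra! hlt
  have hU := card_union_add_dd (A := A) (B := B) (C := C) (by omega)
  have hUsub : A ∪ B ∪ C ⊆ Icc 1 n := union_subset (union_subset hA.1 hB.1) hC.1
  have hcard := card_sdiff_add_card_eq_card hUsub
  rw [Nat.card_Icc] at hcard
  rcases (by omega : dd A B C + 1 = ℓ ∨ dd A B C + 2 = ℓ ∨ dd A B C + 3 = ℓ) with h | h | h
  · obtain ⟨x, hx, y, hy, hxy⟩ := one_lt_card.1 (show 1 < (Icc 1 n \ (A ∪ B ∪ C)).card by omega)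
    simp only [mem_sdiff, mem_union, not_or] at hx hy
    have hxn : x ≠ n + 1 := by have := mem_Icc.1 hx.1; omega
    have hyn : y ≠ n + 1 := by have := mem_Icc.1 hy.1; omega
    have key := hF _ hA' _ (hBx x hx.1 hx.2.1.2) _ (hCx y hy.1 hy.2.2)
    have e1 : insert (n + 1) A ∩ insert x B = A ∩ B :=
      insert_inter_insert_of_ne hxn.symm nB hx.2.1.1
    have e2 : insert x B ∩ insert y C = B ∩ C := insert_inter_insert_of_ne hxy hx.2.2 hy.2.1.2
    have e3 : insert y C ∩ insert (n + 1) A = C ∩ A :=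
      insert_inter_insert_of_ne hyn hy.2.1.1 nC
    unfold dd at *
    rw [e1, e2, e3] at key
    omega
  · obtain ⟨x, hx⟩ := card_pos.1 (show 0 < (Icc 1 n \ (A ∪ B ∪ C)).card by omega)
    simp only [mem_sdiff, mem_union, not_or] at hx
    have hxn : x ≠ n + 1 := by have := mem_Icc.1 hx.1; omega
    have key := hF _ hA' _ hB' _ (hCx x hx.1 hx.2.2)
    have e1 : insert (n + 1) A ∩ insert (n + 1) B = insert (n + 1) (A ∩ B) :=
      (insert_inter_distrib _ _ _).symm
    have e2 : insert (n + 1) B ∩ insert x C = B ∩ C :=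
      insert_inter_insert_of_ne hxn.symm nC hx.2.1.2
    have e3 : insert x C ∩ insert (n + 1) A = C ∩ A :=
      insert_inter_insert_of_ne hxn hx.2.1.1 nC
    unfold dd at *
    rw [e1, e2, e3, card_insert_of_notMem (by simp [nA])] at key
    omega
  · obtain ⟨x, hx⟩ := card_pos.1 (show 0 < A.card by omega)
    have hxn : x ≠ n + 1 := by have := mem_Icc.1 (hA.1 hx); omega
    have hdis : A ∩ B = ∅ ∧ C ∩ A = ∅ := by
      unfold dd at h
      constructor <;> rw [← card_eq_zero] <;> omega
    have hxB : x ∉ B := fun h' => by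
      have := mem_inter.2 ⟨hx, h'⟩; simp [hdis.1] at this
    have hxC : x ∉ C := fun h' => by
      have := mem_inter.2 ⟨h', hx⟩; simp [hdis.2] at this
    have key := hF _ hA' _ hB' _ (hCx x (hA.1 hx) hxC)
    have e1 : insert (n + 1) A ∩ insert (n + 1) B = insert (n + 1) (A ∩ B) :=
      (insert_inter_distrib _ _ _).symm
    have e2 : insert (n + 1) B ∩ insert x C = B ∩ C :=
      insert_inter_insert_of_ne hxn.symm nC hxB
    have e3 : insert x C ∩ insert (n + 1) A = insert x (C ∩ A) := by
      rw [insert_inter_of_mem (by simp [hx]), inter_insert_of_notMem nC]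
    unfold dd at *
    rw [e1, e2, e3, card_insert_of_notMem (by simp [nA]),
      card_insert_of_notMem (by simp [hxC])] at key
    omega

open Finset in
/-- Any bound that dominates the base cases and satisfies Pascal's inequality bounds the size of
families with the triple intersection condition. -/
lemma card_le_of_pascal {ℓ : ℕ} (hℓ : ℓ = 2 ∨ ℓ = 3) (g : ℕ → ℕ → ℕ) (hg0 : ∀ n, 1 ≤ g n 0)
    (hbase : ∀ n m, 3 * (m + 1) = n + ℓ → n.choose (m + 1) ≤ g n m)
    (hpascal : ∀ n m, 1 ≤ n → g n (m + 1) + g n m ≤ g (n + 1) (m + 1)) :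
    ∀ n m, 3 * (m + 1) ≤ n + ℓ → ∀ F : Finset (Finset ℕ), F ⊆ (Icc 1 n).powersetCard (m + 1) →
      (∀ A ∈ F, ∀ B ∈ F, ∀ C ∈ F, ℓ ≤ dd A B C) → F.card ≤ g n m := by
  intro n
  induction n with
  | zero =>
    intro m hm F hsub _
    refine le_trans ?_ (hbase 0 m (by omega))
    simpa using card_le_card hsub
  | succ n ih =>
    intro m hm F hsub hF
    rcases hm.eq_or_lt with heq | hlt
    · refine le_trans ?_ (hbase _ m heq)
      simpa using card_le_card hsub
    rcases m with _ | m
    · refine le_trans (card_le_one.2 fun A hA B hB => ?_) (hg0 _)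
      have h := hF A hA A hA B hB
      have cA := (mem_powersetCard.1 (hsub hA)).2
      have cB := (mem_powersetCard.1 (hsub hB)).2
      obtain ⟨a, rfl⟩ := card_eq_one.1 cA
      obtain ⟨b, rfl⟩ := card_eq_one.1 cB
      by_contra hne
      have hab : a ≠ b := fun h => hne (by rw [h])
      simp [dd, hab, hab.symm] at h
      omega
    obtain ⟨G, hcard, hGsub, hG, hst⟩ := exists_stable_family hsub hF
    rw [← hcard, ← card_filter_add_card_filter_not (s := G) (n + 1 ∉ ·)]
    refine le_trans (add_le_add ?_ ?_) (hpascal n m (by omega))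
    · refine ih (m + 1) (by omega) _ (fun A hA => ?_) fun A hA B hB C hC =>
        hG A (mem_filter.1 hA).1 B (mem_filter.1 hB).1 C (mem_filter.1 hC).1
      rw [mem_filter] at hA
      have hm' := mem_powersetCard.1 (hGsub hA.1)
      refine mem_powersetCard.2 ⟨fun y hy => ?_, hm'.2⟩
      have h1 := mem_Icc.1 (hm'.1 hy)
      have h2 : y ≠ n + 1 := fun h => hA.2 (h ▸ hy)
      exact mem_Icc.2 ⟨h1.1, by omega⟩
    · set L := (G.filter (¬ n + 1 ∉ ·)).image (fun A => A.erase (n + 1)) with hL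
      have hLcard : L.card = (G.filter (¬ n + 1 ∉ ·)).card := by
        refine card_image_of_injOn fun A hA B hB hAB => ?_
        simp only [coe_filter, Set.mem_ofPred_eq, not_not] at hA hB
        rw [← insert_erase hA.2, ← insert_erase hB.2]
        exact congrArg _ hAB
      have hLmem : ∀ A ∈ L, A ∈ (Icc 1 n).powersetCard (m + 1) ∧ n + 1 ∉ A ∧
          insert (n + 1) A ∈ G := by
        intro A hA
        obtain ⟨B, hB, rfl⟩ := mem_image.1 hA
        rw [mem_filter, not_not] at hB
        have hm' := mem_powersetCard.1 (hGsub hB.1)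
        refine ⟨mem_powersetCard.2 ⟨fun y hy => ?_, ?_⟩, by simp, by
          rw [insert_erase hB.2]; exact hB.1⟩
        · have h1 := mem_Icc.1 (hm'.1 (mem_of_mem_erase hy))
          have h2 := ne_of_mem_erase hy
          exact mem_Icc.2 ⟨h1.1, by omega⟩
        · rw [card_erase_of_mem hB.2, hm'.2]; omega
      rw [← hLcard]
      refine ih m (by omega) L (fun A hA => (hLmem A hA).1) fun A hA B hB C hC => ?_
      obtain ⟨hA1, hA2, hA3⟩ := hLmem A hA
      obtain ⟨hB1, hB2, hB3⟩ := hLmem B hB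
      obtain ⟨hC1, hC2, hC3⟩ := hLmem C hC
      exact le_dd_link hℓ (by omega) hG hA1 hB1 hC1 hA3 hB3 (hst B hB2 hB3) (hst C hC2 hC3)

/-- The bound for `ℓ = 2` and sets of size `m + 1`. -/
def twoBound (n : ℕ) : ℕ → ℕ
  | 0 => 1
  | m + 1 => (n + 1).choose (m + 1) + n.choose m

/-- The bound for `ℓ = 3` and sets of size `m + 1`. -/
def threeBound (n : ℕ) : ℕ → ℕ
  | 0 => 1
  | 1 => n
  | m + 2 => n.choose (m + 2) + 2 * n.choose m + 3 * (n - 1).choose m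

lemma choose_le_twoBound (n m : ℕ) (h : 3 * (m + 1) = n + 2) :
    n.choose (m + 1) ≤ twoBound n m := by
  rcases m with _ | p
  · obtain rfl : n = 1 := by omega
    simp [twoBound]
  · obtain rfl : n = 3 * p + 4 := by omega
    have h1 := Nat.choose_succ_right_eq (3 * p + 4) (p + 1)
    have h0 := Nat.choose_succ_right_eq (3 * p + 4) p
    rw [show 3 * p + 4 - (p + 1) = 2 * p + 3 by omega] at h1
    rw [show 3 * p + 4 - p = 2 * p + 4 by omega] at h0
    rw [twoBound, Nat.choose_succ_succ' (3 * p + 4) p]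
    refine le_of_mul_le_mul_right (a := p + 2) (le_of_eq ?_) (by omega)
    linarith

lemma choose_le_threeBound (n m : ℕ) (h : 3 * (m + 1) = n + 3) :
    n.choose (m + 1) ≤ threeBound n m := by
  rcases m with _ | _ | p
  · obtain rfl : n = 0 := by omega
    simp [threeBound]
  · obtain rfl : n = 3 := by omega
    decide
  · obtain rfl : n = 3 * p + 6 := by omega
    have h2 := Nat.choose_succ_right_eq (3 * p + 6) (p + 2)
    have h1 := Nat.choose_succ_right_eq (3 * p + 6) (p + 1)
    have h0 := Nat.choose_succ_right_eq (3 * p + 6) p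
    have h3 := Nat.choose_mul_succ_eq (3 * p + 5) p
    rw [show 3 * p + 6 - (p + 2) = 2 * p + 4 by omega] at h2
    rw [show 3 * p + 6 - (p + 1) = 2 * p + 5 by omega] at h1
    rw [show 3 * p + 6 - p = 2 * p + 6 by omega] at h0
    rw [show 3 * p + 5 + 1 - p = 2 * p + 6 by omega] at h3
    refine le_of_eq ?_
    rw [threeBound, show 3 * p + 6 - 1 = 3 * p + 5 by omega]
    simp only [add_assoc, Nat.reduceAdd] at h0 h1 h2 h3 ⊢
    generalize (3 * p + 6).choose (p + 3) = x3 at *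
    generalize (3 * p + 6).choose (p + 2) = x2 at *
    generalize (3 * p + 6).choose (p + 1) = x1 at *
    generalize (3 * p + 6).choose p = x0 at *
    generalize (3 * p + 5).choose p = y0 at *
    qify at *
    have e1 : (x1 : ℚ) = x0 * (2 * p + 6) / (p + 1) := by field_simp; linarith
    have e2 : (x2 : ℚ) = x1 * (2 * p + 5) / (p + 2) := by field_simp; linarith
    have e3 : (x3 : ℚ) = x2 * (2 * p + 4) / (p + 3) := by field_simp; linarith
    have e4 : (y0 : ℚ) = x0 * (2 * p + 6) / (3 * p + 6) := by field_simp; linarith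
    rw [e3, e2, e4, e1]
    field_simp
    ring

lemma twoBound_pascal (n m : ℕ) :
    twoBound n (m + 1) + twoBound n m ≤ twoBound (n + 1) (m + 1) := by
  rcases m with _ | m
  · simp [twoBound]
  · simp only [twoBound]
    rw [Nat.choose_succ_succ' (n + 1) (m + 1), Nat.choose_succ_succ' n m]
    omega

lemma threeBound_pascal (n m : ℕ) (hn : 1 ≤ n) :
    threeBound n (m + 1) + threeBound n m ≤ threeBound (n + 1) (m + 1) := by
  obtain ⟨n, rfl⟩ := Nat.exists_eq_add_of_le' hn
  rcases m with _ | _ | m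
  · simp [threeBound]
  · simp only [threeBound, Nat.choose_succ_succ' (n + 1) 1]
    simp
    omega
  · simp only [threeBound, Nat.add_sub_cancel]
    have h1 := Nat.choose_succ_succ' (n + 1) (m + 2)
    have h2 := Nat.choose_succ_succ' (n + 1) m
    have h3 := Nat.choose_succ_succ' n m
    have e : m + 1 + 2 = m + 2 + 1 := rfl
    rw [e]
    omega

theorem stmt8 (n k ℓ : ℕ) (hk : 2 ≤ k) (hℓ : ℓ = 2 ∨ ℓ = 3) (hn : 3 * k - ℓ ≤ n)
    (𝓕 : Finset (Finset ℕ)) (h𝓕 : 𝓕 ⊆ (Finset.Icc 1 n).powersetCard k)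
    (hd : ∀ A ∈ 𝓕, ∀ B ∈ 𝓕, ∀ C ∈ 𝓕, ℓ ≤ dd A B C) :
    (ℓ = 2 → 𝓕.card ≤ (n + 1).choose (k - 1) + n.choose (k - 2)) ∧
    (ℓ = 3 → 𝓕.card ≤ n.choose (k - 1) + 2 * n.choose (k - 3) + 3 * (n - 1).choose (k - 3)) := by
  obtain ⟨m, rfl⟩ := Nat.exists_eq_add_of_le' hk
  constructor
  · rintro rfl
    exact card_le_of_pascal hℓ twoBound (fun _ => le_rfl) choose_le_twoBound
      (fun n m _ => twoBound_pascal n m) n (m + 1) (by omega) 𝓕 h𝓕 hd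
  · rintro rfl
    have h := card_le_of_pascal hℓ threeBound (fun _ => le_rfl) choose_le_threeBound
      threeBound_pascal n (m + 1) (by omega) 𝓕 h𝓕 hd
    rcases m with _ | m
    · simp only [threeBound] at h
      simp
      omega
    · exact h
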